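/- (Corollary 4.3 i.) Suppose either (a) there are a, b ≥ 0 with ‖V x‖ ≤ a‖x‖ + b‖G x‖ for all x ∈ D and δ := a + b m < m, or (b) there are α, β ≥ 0 with ‖V x‖² ≤ α‖x‖² + β‖G x‖² for all x ∈ D and δ := √(α + β m²) < m. Then the form polynomial t is strongly damped and for every x ∈ D ∖ {0} one has p_−(x) ≤ −m + δ and p_+(x) ≥ m − δ; in particular t(λ)[x] > 0 for every λ ∈ (−m + δ, m − δ) and every x ∈ D ∖ {0}. -/

import Mathlib

/-- The abstract Klein–Gordon quadratic form `t(λ)[x] = ‖G x‖² − ‖V x − λ x‖²`. -/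
noncomputable def kgForm {H : Type*} [NormedAddCommGroup H] [InnerProductSpace ℂ H]
    {D : Submodule ℂ H} (G V : D →ₗ[ℂ] H) (μ : ℝ) (x : D) : ℝ :=
  ‖G x‖ ^ 2 - ‖V x - (μ : ℂ) • (x : H)‖ ^ 2

/-- The Klein–Gordon form is a quadratic polynomial in the spectral parameter. -/
theorem kgForm_eq_quadratic {H : Type*} [NormedAddCommGroup H] [InnerProductSpace ℂ H]
    {D : Submodule ℂ H} (G V : D →ₗ[ℂ] H) (μ : ℝ) (x : D) :
    kgForm G V μ x = (‖G x‖ ^ 2 - ‖V x‖ ^ 2) + 2 * (inner ℂ (V x) (x : H)).re * μ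
      - ‖(x : H)‖ ^ 2 * μ ^ 2 := by
  have h := norm_sub_sq (𝕜 := ℂ) (V x) ((μ : ℂ) • (x : H))
  rw [inner_smul_right, norm_smul, Complex.norm_real, Real.norm_eq_abs, mul_pow, sq_abs] at h
  simp only [RCLike.re_to_complex, Complex.re_ofReal_mul] at h
  rw [kgForm, h]
  ring

/-- The Klein–Gordon form is nonnegative at every parameter `μ` with
`‖V x‖ + |μ| ‖x‖ ≤ ‖G x‖`. -/
theorem kgForm_nonneg {H : Type*} [NormedAddCommGroup H] [InnerProductSpace ℂ H]
    {D : Submodule ℂ H} (G V : D →ₗ[ℂ] H) {μ : ℝ} {x : D}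
    (h : ‖V x‖ + |μ| * ‖(x : H)‖ ≤ ‖G x‖) : 0 ≤ kgForm G V μ x := by
  have h₁ := norm_sub_le (V x) ((μ : ℂ) • (x : H))
  rw [norm_smul, Complex.norm_real, Real.norm_eq_abs] at h₁
  exact sub_nonneg.2 (pow_le_pow_left₀ (norm_nonneg _) (h₁.trans h) 2)

/-- The Klein–Gordon form is positive at every parameter `μ` with
`‖V x‖ + |μ| ‖x‖ < ‖G x‖`. -/
theorem kgForm_pos {H : Type*} [NormedAddCommGroup H] [InnerProductSpace ℂ H]
    {D : Submodule ℂ H} (G V : D →ₗ[ℂ] H) {μ : ℝ} {x : D}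
    (h : ‖V x‖ + |μ| * ‖(x : H)‖ < ‖G x‖) : 0 < kgForm G V μ x := by
  have h₁ := norm_sub_le (V x) ((μ : ℂ) • (x : H))
  rw [norm_smul, Complex.norm_real, Real.norm_eq_abs] at h₁
  exact sub_pos.2 (pow_lt_pow_left₀ (h₁.trans_lt h) (norm_nonneg _) two_ne_zero)

/-- A linear relative bound forces a gap between `g` and `v`. -/
theorem add_gap_le_of_linear_bound {m a b s g v : ℝ} (hm : 0 < m) (ha : 0 ≤ a)
    (hab : a + b * m < m) (hg : m * s ≤ g) (hv : v ≤ a * s + b * g) :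
    v + (m - (a + b * m)) * s ≤ g := by
  have hb : b < 1 := by
    by_contra! hb
    nlinarith
  nlinarith [mul_nonneg (sub_nonneg.2 hb.le) (sub_nonneg.2 hg)]

/-- A quadratic relative bound forces a gap between `g` and `v`. -/
theorem add_gap_le_of_quadratic_bound {m α β s g v : ℝ} (hm : 0 < m) (hα : 0 ≤ α)
    (hβ : 0 ≤ β) (hs : 0 ≤ s) (hαβ : √(α + β * m ^ 2) < m) (hg : m * s ≤ g)
    (hv : v ^ 2 ≤ α * s ^ 2 + β * g ^ 2) :
    v + (m - √(α + β * m ^ 2)) * s ≤ g := by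
  have hδ : √(α + β * m ^ 2) ^ 2 = α + β * m ^ 2 := Real.sq_sqrt (by positivity)
  have hδ₀ : 0 ≤ √(α + β * m ^ 2) := Real.sqrt_nonneg _
  generalize √(α + β * m ^ 2) = δ at *
  have hβ₁ : β ≤ 1 := by
    by_contra! h
    nlinarith [pow_pos hm 2]
  have hβm : β * m ≤ δ := by
    refine le_of_sq_le_sq ?_ hδ₀
    nlinarith [mul_nonneg (mul_nonneg hβ (sub_nonneg.2 hβ₁)) (sq_nonneg m)]
  obtain ⟨h, rfl⟩ : ∃ h, g = m * s + h := ⟨g - m * s, by ring⟩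
  have hh : 0 ≤ h := by linarith
  have key : v ≤ δ * s + h := by
    refine le_of_sq_le_sq ?_ (by positivity)
    have h₁ : α * s ^ 2 = (δ ^ 2 - β * m ^ 2) * s ^ 2 := by rw [hδ]; ring
    nlinarith [mul_nonneg (sub_nonneg.2 hβm) (mul_nonneg hs hh),
      mul_nonneg (sub_nonneg.2 hβ₁) (sq_nonneg h)]
  linarith

/-- A concave real quadratic that is positive somewhere has exactly two distinct zeros, and
these enclose every point at which the quadratic is nonnegative. -/
theorem exists_zeros_of_concave_quadratic {S B C t : ℝ} (hS : 0 < S)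
    (ht : 0 < C + 2 * B * t - S * t ^ 2) :
    ∃ p q : ℝ, p < q ∧ (∀ μ, C + 2 * B * μ - S * μ ^ 2 = 0 ↔ μ = p ∨ μ = q) ∧
      ∀ μ, 0 ≤ C + 2 * B * μ - S * μ ^ 2 → p ≤ μ ∧ μ ≤ q := by
  have hdisc : 0 < B ^ 2 + S * C := by
    nlinarith [mul_pos hS ht, sq_nonneg (S * t - B)]
  set r := √(B ^ 2 + S * C)
  have hr : 0 < r := Real.sqrt_pos.2 hdisc
  have hr₂ : r ^ 2 = B ^ 2 + S * C := Real.sq_sqrt hdisc.le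
  refine ⟨(B - r) / S, (B + r) / S, by gcongr; linarith, fun μ => ?_, fun μ hμ => ?_⟩
  · rw [eq_div_iff hS.ne', eq_div_iff hS.ne']
    have hfac : S * (C + 2 * B * μ - S * μ ^ 2) =
        -((μ * S - (B - r)) * (μ * S - (B + r))) := by
      linear_combination -hr₂
    rw [← sub_eq_zero (b := B - r), ← sub_eq_zero (b := B + r), ← mul_eq_zero, ← neg_eq_zero,
      ← neg_eq_zero (a := (μ * S - (B - r)) * (μ * S - (B + r))), ← hfac, neg_eq_zero,
      mul_eq_zero, or_iff_right hS.ne']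
  · have h : |μ * S - B| ≤ r := abs_le_of_sq_le_sq (by nlinarith [mul_nonneg hS.le hμ]) hr.le
    rw [div_le_iff₀ hS, le_div_iff₀ hS]
    constructor <;> linarith [abs_le.1 h |>.1, abs_le.1 h |>.2]

/-- Corollary 4.3 i): if either `‖V x‖ ≤ a‖x‖ + b‖G x‖` with `δ = a + b m < m`, or
`‖V x‖² ≤ α‖x‖² + β‖G x‖²` with `δ = √(α + β m²) < m`, then the form polynomial `t`
is strongly damped with `p₋(x) ≤ −m + δ`, `p₊(x) ≥ m − δ`, and `t(λ)[x] > 0` for every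
`λ ∈ (−m + δ, m − δ)` and every `x ∈ D ∖ {0}`. -/
theorem strongly_damped_of_relative_bound
    {H : Type*} [NormedAddCommGroup H] [InnerProductSpace ℂ H]
    (m : ℝ) (hm : 0 < m) (D : Submodule ℂ H) (G V : D →ₗ[ℂ] H)
    (hG : ∀ x : D, m * ‖(x : H)‖ ≤ ‖G x‖)
    (δ : ℝ)
    (hδ : (∃ a b : ℝ, 0 ≤ a ∧ 0 ≤ b ∧
            (∀ x : D, ‖V x‖ ≤ a * ‖(x : H)‖ + b * ‖G x‖) ∧ δ = a + b * m) ∨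
          (∃ α β : ℝ, 0 ≤ α ∧ 0 ≤ β ∧
            (∀ x : D, ‖V x‖ ^ 2 ≤ α * ‖(x : H)‖ ^ 2 + β * ‖G x‖ ^ 2) ∧
            δ = Real.sqrt (α + β * m ^ 2)))
    (hδm : δ < m) :
    (∀ x : D, x ≠ 0 → ∃ p q : ℝ, p < q ∧
      kgForm G V p x = 0 ∧ kgForm G V q x = 0 ∧
      (∀ μ : ℝ, kgForm G V μ x = 0 → μ = p ∨ μ = q) ∧
      p ≤ -m + δ ∧ m - δ ≤ q) ∧
    (∀ lam : ℝ, -m + δ < lam → lam < m - δ →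
      ∀ x : D, x ≠ 0 → 0 < kgForm G V lam x) := by
  have gap (x : D) : ‖V x‖ + (m - δ) * ‖(x : H)‖ ≤ ‖G x‖ := by
    rcases hδ with ⟨a, b, ha, -, hV, rfl⟩ | ⟨α, β, hα, hβ, hV, rfl⟩
    · exact add_gap_le_of_linear_bound hm ha hδm (hG x) (hV x)
    · exact add_gap_le_of_quadratic_bound hm hα hβ (norm_nonneg _) hδm (hG x) (hV x)
  have pos (lam : ℝ) (h₁ : -m + δ < lam) (h₂ : lam < m - δ) (x : D) (hx : x ≠ 0) :
      0 < kgForm G V lam x := by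
    have hx' : 0 < ‖(x : H)‖ := by simpa using hx
    have hlam : |lam| < m - δ := abs_lt.2 ⟨by linarith, h₂⟩
    exact kgForm_pos G V (by linarith [gap x, mul_lt_mul_of_pos_right hlam hx'])
  refine ⟨fun x hx => ?_, pos⟩
  have hx' : 0 < ‖(x : H)‖ := by simpa using hx
  have h₀ := pos 0 (by linarith) (by linarith) x hx
  have habs : |m - δ| = m - δ := abs_of_pos (by linarith)
  have hl : 0 ≤ kgForm G V (-(m - δ)) x := kgForm_nonneg G V (by rw [abs_neg, habs]; exact gap x)
  have hr : 0 ≤ kgForm G V (m - δ) x := kgForm_nonneg G V (by rw [habs]; exact gap x)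
  simp only [kgForm_eq_quadratic] at h₀ hl hr ⊢
  obtain ⟨p, q, hpq, hzero, hbetween⟩ := exists_zeros_of_concave_quadratic (pow_pos hx' 2) h₀
  exact ⟨p, q, hpq, (hzero p).2 (Or.inl rfl), (hzero q).2 (Or.inr rfl), fun μ => (hzero μ).1,
    by linarith [(hbetween _ hl).1], (hbetween _ hr).2⟩
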